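/- The SG-generating map is well-defined with respect to splitting the marginalisation and conditioning sets: for a summary graph H = (N,F) and pairwise disjoint subsets C, C₁, M, M₁ of N, α_SG(α_SG(H;M,C);M₁,C₁) = α_SG(H;M∪M₁,C∪C₁). -/

import Mathlib

/-!
Stable mixed graphs: mixed graphs with arrows, arcs and lines; ribbonless,
summary and ancestral graphs; the generating maps α_RG, α_SG, α_AG;
m-connecting paths, m-separation and induced independence models.
-/

namespace StableMixedGraphs

/-- A mixed graph on node type `V`: a node set together with three edge
relations: arrows (`arrow i j` means an arrow from `i` to `j`), arcs
(two-headed, symmetric) and lines (undirected, symmetric). -/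
structure MixedGraph (V : Type) where
  nodes : Set V
  arrow : V → V → Prop
  arc : V → V → Prop
  line : V → V → Prop

namespace MixedGraph

variable {V W : Type}

/-- Wellformedness: arcs and lines are symmetric relations and all edges join
nodes of the graph. -/
def Wf (G : MixedGraph V) : Prop :=
  (∀ i j, G.arc i j → G.arc j i) ∧
  (∀ i j, G.line i j → G.line j i) ∧
  (∀ i j, G.arrow i j ∨ G.arc i j ∨ G.line i j → i ∈ G.nodes ∧ j ∈ G.nodes)

/-- No loops of any of the three kinds. -/
def Loopless (G : MixedGraph V) : Prop :=
  ∀ i, ¬ G.arrow i i ∧ ¬ G.arc i i ∧ ¬ G.line i i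

/-- A loopless mixed graph with a finite node set. -/
def IsLMG (G : MixedGraph V) : Prop := G.Wf ∧ G.Loopless ∧ G.nodes.Finite

/-- `G.anc i j` : `i` is an ancestor of `j`, i.e. there is a
direction-preserving path from `i` to `j`. -/
def anc (G : MixedGraph V) (i j : V) : Prop := Relation.TransGen G.arrow i j

/-- The set of ancestors of nodes of `C`. -/
def anSet (G : MixedGraph V) (C : Set V) : Set V := {a | ∃ c ∈ C, G.anc a c}

/-- `i` lies on a direction-preserving cycle. -/
def OnDPCycle (G : MixedGraph V) (i : V) : Prop := G.anc i i

/-- `i` is an endpoint of a line. -/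
def LineEndpoint (G : MixedGraph V) (i : V) : Prop := ∃ j, G.line i j

/-- Condition (2) of a ribbon: `i` or a descendant of `i` is an endpoint of a
line or lies on a direction-preserving cycle. -/
def RibbonTail (G : MixedGraph V) (i : V) : Prop :=
  ∃ d, (d = i ∨ G.anc i d) ∧ (G.LineEndpoint d ∨ G.OnDPCycle d)

/-- `G` contains a ribbon: a collider V-configuration `⟨h,i,j⟩` with no
endpoint-identical edge between `h` and `j`, whose inner node `i` (or a
descendant of it) is an endpoint of a line or on a direction-preserving
cycle. -/
def HasRibbon (G : MixedGraph V) : Prop :=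
  ∃ h i j, h ≠ i ∧ i ≠ j ∧ h ≠ j ∧ G.RibbonTail i ∧
    ((G.arc h i ∧ G.arc i j ∧ ¬ G.arc h j) ∨
     (G.arrow h i ∧ G.arrow j i ∧ ¬ G.line h j) ∨
     (G.arrow h i ∧ G.arc i j ∧ ¬ G.arrow h j))

/-- A ribbonless graph: a loopless mixed graph with no ribbon. -/
def IsRG (G : MixedGraph V) : Prop := G.IsLMG ∧ ¬ G.HasRibbon

/-- A directed acyclic graph: only arrows, no direction-preserving cycle. -/
def IsDAG (G : MixedGraph V) : Prop :=
  G.IsLMG ∧ (∀ i j, ¬ G.arc i j) ∧ (∀ i j, ¬ G.line i j) ∧ ∀ i, ¬ G.anc i i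

/-- A summary graph: a loopless mixed graph with no arrowhead pointing to an
endpoint of a line and no direction-preserving cycle. -/
def IsSG (G : MixedGraph V) : Prop :=
  G.IsLMG ∧ (∀ i, G.LineEndpoint i → ∀ k, ¬ G.arrow k i ∧ ¬ G.arc k i) ∧
    ∀ i, ¬ G.anc i i

/-- A simple mixed graph: no loops and no multiple edges. -/
def Simple (G : MixedGraph V) : Prop :=
  G.Loopless ∧ ∀ i j,
    (G.arrow i j → ¬ G.arrow j i ∧ ¬ G.arc i j ∧ ¬ G.line i j) ∧
    (G.arc i j → ¬ G.line i j)

/-- An ancestral graph: a simple mixed graph such that no node is an ancestor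
of one of its parents or spouses, and a node with a neighbour has neither
parents nor spouses. -/
def IsAG (G : MixedGraph V) : Prop :=
  G.Wf ∧ G.Simple ∧ G.nodes.Finite ∧
  (∀ i j, G.arrow j i ∨ G.arc j i → ¬ G.anc i j) ∧
  (∀ i, G.LineEndpoint i → ∀ k, ¬ G.arrow k i ∧ ¬ G.arc k i)

/-- An undirected graph: only lines. -/
def IsUG (G : MixedGraph V) : Prop :=
  G.IsLMG ∧ (∀ i j, ¬ G.arrow i j) ∧ ∀ i j, ¬ G.arc i j

/-- A bidirected graph: only arcs. -/
def IsBG (G : MixedGraph V) : Prop :=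
  G.IsLMG ∧ (∀ i j, ¬ G.arrow i j) ∧ ∀ i j, ¬ G.line i j

/-- Image of a mixed graph under a map of node types. -/
def map (f : V → W) (G : MixedGraph V) : MixedGraph W where
  nodes := f '' G.nodes
  arrow a b := ∃ i j, G.arrow i j ∧ f i = a ∧ f j = b
  arc a b := ∃ i j, G.arc i j ∧ f i = a ∧ f j = b
  line a b := ∃ i j, G.line i j ∧ f i = a ∧ f j = b

end MixedGraph

/-! ### The closure generating new edges (Table 1 of the RG-generating
algorithm), for given marginalisation set `M` and collider set
`S = C ∪ an(C)`.  For every V-configuration whose inner node is a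
non-collider in `M` (rows 1–7) or a collider in `S` (rows 8–10) the
endpoint-identical edge between the endpoints is generated, repeatedly
until closure. -/

mutual
  /-- Generated arrows (`GenArrow H M S j i`: arrow from `j` to `i`). -/
  inductive GenArrow {V : Type} (H : MixedGraph V) (M S : Set V) : V → V → Prop
    | base {i j : V} : H.arrow i j → GenArrow H M S i j
    | row1 {i j m : V} : m ∈ M → j ≠ i →
        GenArrow H M S j m → GenArrow H M S m i → GenArrow H M S j i
    | row2 {i j m : V} : m ∈ M → j ≠ i →
        GenLine H M S j m → GenArrow H M S m i → GenArrow H M S j i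
    | row3 {i j m : V} : m ∈ M → j ≠ i →
        GenLine H M S j m → GenArc H M S m i → GenArrow H M S j i
    | row8 {i j s : V} : s ∈ S → j ≠ i →
        GenArrow H M S j s → GenArc H M S s i → GenArrow H M S j i

  /-- Generated arcs. -/
  inductive GenArc {V : Type} (H : MixedGraph V) (M S : Set V) : V → V → Prop
    | base {i j : V} : H.arc i j → GenArc H M S i j
    | symm {i j : V} : GenArc H M S i j → GenArc H M S j i
    | row4 {i j m : V} : m ∈ M → i ≠ j →
        GenArrow H M S m i → GenArrow H M S m j → GenArc H M S i j
    | row5 {i j m : V} : m ∈ M → i ≠ j →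
        GenArrow H M S m i → GenArc H M S m j → GenArc H M S i j
    | row9 {i j s : V} : s ∈ S → i ≠ j →
        GenArc H M S i s → GenArc H M S s j → GenArc H M S i j

  /-- Generated lines. -/
  inductive GenLine {V : Type} (H : MixedGraph V) (M S : Set V) : V → V → Prop
    | base {i j : V} : H.line i j → GenLine H M S i j
    | symm {i j : V} : GenLine H M S i j → GenLine H M S j i
    | row6 {i j m : V} : m ∈ M → i ≠ j →
        GenLine H M S i m → GenArrow H M S j m → GenLine H M S i j
    | row7 {i j m : V} : m ∈ M → i ≠ j →
        GenLine H M S i m → GenLine H M S m j → GenLine H M S i j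
    | row10 {i j s : V} : s ∈ S → i ≠ j →
        GenArrow H M S i s → GenArrow H M S j s → GenLine H M S i j
end

variable {V : Type}

/-- The RG-generating map `α_RG(H;M,C)`: generate all edges of the closure
and delete the nodes of `M ∪ C`. -/
def alphaRG (H : MixedGraph V) (M C : Set V) : MixedGraph V where
  nodes := H.nodes \ (M ∪ C)
  arrow i j := i ∈ H.nodes \ (M ∪ C) ∧ j ∈ H.nodes \ (M ∪ C) ∧
    GenArrow H M (C ∪ H.anSet C) i j
  arc i j := i ∈ H.nodes \ (M ∪ C) ∧ j ∈ H.nodes \ (M ∪ C) ∧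
    GenArc H M (C ∪ H.anSet C) i j
  line i j := i ∈ H.nodes \ (M ∪ C) ∧ j ∈ H.nodes \ (M ∪ C) ∧
    GenLine H M (C ∪ H.anSet C) i j

/-- The arrowhead-removal operation `α_RG.SG(K;A)`: every arrowhead pointing
at a node of `A` is removed (an arrow at such a node becomes a line, an arc
becomes an arrow, an arc with both endpoints in `A` becomes a line),
repeatedly until closure. -/
def deheadAt (K : MixedGraph V) (A : Set V) : MixedGraph V where
  nodes := K.nodes
  arrow j i := i ∉ A ∧ (K.arrow j i ∨ (K.arc j i ∧ j ∈ A))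
  arc i j := K.arc i j ∧ i ∉ A ∧ j ∉ A
  line i j := K.line i j ∨ (K.arrow j i ∧ i ∈ A) ∨ (K.arrow i j ∧ j ∈ A) ∨
    (K.arc i j ∧ i ∈ A ∧ j ∈ A)

/-- The SG-generating map `α_SG(H;M,C)`: mark the nodes of `an(C)`, apply the
RG-generating construction, then remove all arrowheads pointing at marked
nodes. -/
def alphaSG (H : MixedGraph V) (M C : Set V) : MixedGraph V :=
  deheadAt (alphaRG H M C) (H.anSet C)

/-! ### Step 2 of the AG-generating algorithm: for every V-configuration
`j → k ↔ i` or `j ↔ k ↔ i` with `k ∈ an(i)` (in the current graph) generate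
an arrow from `j` to `i`, respectively an arc between `j` and `i`, until
closure. -/

mutual
  inductive AG2Arrow {V : Type} (K : MixedGraph V) : V → V → Prop
    | base {i j : V} : K.arrow j i → AG2Arrow K j i
    | gen {i j k : V} : j ≠ i → AG2Arrow K j k → AG2Arc K k i →
        AG2Anc K k i → AG2Arrow K j i

  inductive AG2Arc {V : Type} (K : MixedGraph V) : V → V → Prop
    | base {i j : V} : K.arc i j → AG2Arc K i j
    | symm {i j : V} : AG2Arc K i j → AG2Arc K j i
    | gen {i j k : V} : j ≠ i → AG2Arc K j k → AG2Arc K k i →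
        AG2Anc K k i → AG2Arc K j i

  /-- The ancestor relation of the graph being generated in step 2. -/
  inductive AG2Anc {V : Type} (K : MixedGraph V) : V → V → Prop
    | single {i j : V} : AG2Arrow K i j → AG2Anc K i j
    | tail {i k j : V} : AG2Arrow K i k → AG2Anc K k j → AG2Anc K i j
end

/-- The graph after step 2 of the AG-generating algorithm. -/
def ag2 (K : MixedGraph V) : MixedGraph V where
  nodes := K.nodes
  arrow := AG2Arrow K
  arc := AG2Arc K
  line := K.line

/-! ### Step 3 of the AG-generating algorithm: repeatedly replace every arc
between `j` and `i` with `j ∈ an(i)` (in the current graph) by an arrow from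
`j` to `i`. -/

mutual
  inductive AG3Arrow {V : Type} (K : MixedGraph V) : V → V → Prop
    | base {i j : V} : K.arrow j i → AG3Arrow K j i
    | conv {i j : V} : K.arc j i → AG3Anc K j i → AG3Arrow K j i

  /-- The ancestor relation of the graph being generated in step 3. -/
  inductive AG3Anc {V : Type} (K : MixedGraph V) : V → V → Prop
    | single {i j : V} : AG3Arrow K i j → AG3Anc K i j
    | tail {i k j : V} : AG3Arrow K i k → AG3Anc K k j → AG3Anc K i j
end

/-- Steps 2 and 3 of the AG-generating algorithm, applied to a summary
graph: `α_SG.AG`. -/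
def alphaSGAG (K : MixedGraph V) : MixedGraph V :=
  let K2 := ag2 K
  { nodes := K.nodes
    arrow := AG3Arrow K2
    arc := fun i j => K2.arc i j ∧ ¬ AG3Anc K2 i j ∧ ¬ AG3Anc K2 j i
    line := K.line }

/-- The AG-generating map `α_AG(H;M,C)`. -/
def alphaAG (H : MixedGraph V) (M C : Set V) : MixedGraph V :=
  alphaSGAG (alphaSG H M C)

/-! ### Paths, m-connection and m-separation. -/

/-- A step of a walk: it goes from `src` to `tgt` along an edge which has an
arrowhead at `src` iff `hs = true` and an arrowhead at `tgt` iff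
`ht = true` (so `hs = ht = false` is a line, `hs = ht = true` an arc, and
exactly one head an arrow in the corresponding direction). -/
structure Step (V : Type) where
  src : V
  tgt : V
  hs : Bool
  ht : Bool

/-- The edge of a step is present in `G`. -/
def Step.valid (G : MixedGraph V) (s : Step V) : Prop :=
  match s.hs, s.ht with
  | false, false => G.line s.src s.tgt
  | false, true  => G.arrow s.src s.tgt
  | true,  false => G.arrow s.tgt s.src
  | true,  true  => G.arc s.src s.tgt

/-- `w` is a path from `i` to `j` in `G`: a nonempty chained list of valid
steps with no repeated nodes. -/
def IsPath (G : MixedGraph V) (i j : V) (w : List (Step V)) : Prop :=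
  w ≠ [] ∧ (∀ s ∈ w, s.valid G) ∧ List.Chain' (fun a b => a.tgt = b.src) w ∧
    w.head?.map Step.src = some i ∧ w.getLast?.map Step.tgt = some j ∧
    (i :: w.map Step.tgt).Nodup

/-- The path `w` is m-connecting given `M` and `C`: every inner collider node
is in `C ∪ an(C)` and every inner non-collider node is in `M`. -/
def MConnPath (G : MixedGraph V) (M C : Set V) (w : List (Step V)) : Prop :=
  List.Chain'
    (fun a b =>
      (a.ht = true ∧ b.hs = true → a.tgt ∈ C ∪ G.anSet C) ∧
      (¬ (a.ht = true ∧ b.hs = true) → a.tgt ∈ M)) w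

/-- `A ⊥_m B | C` in `G` : there is no m-connecting path between `A` and `B`
given `C` (with `M` the remaining nodes). -/
def MSep (G : MixedGraph V) (A B C : Set V) : Prop :=
  ∀ i ∈ A, ∀ j ∈ B, ∀ w : List (Step V),
    IsPath G i j w → ¬ MConnPath G (G.nodes \ (A ∪ B ∪ C)) C w

/-- The independence model induced by `G` via m-separation: the set of
triples `⟨A,B|C⟩` of pairwise disjoint subsets of the nodes with
`A ⊥_m B | C`. -/
def Jm (G : MixedGraph V) : Set (Set V × Set V × Set V) :=
  {t | t.1 ⊆ G.nodes ∧ t.2.1 ⊆ G.nodes ∧ t.2.2 ⊆ G.nodes ∧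
    Disjoint t.1 t.2.1 ∧ Disjoint t.1 t.2.2 ∧ Disjoint t.2.1 t.2.2 ∧
    MSep G t.1 t.2.1 t.2.2}

/-- The independence model after marginalisation over `M` and conditioning on
`C` : `α(J;M,C)`. -/
def alphaIM (J : Set (Set V × Set V × Set V)) (M C : Set V) :
    Set (Set V × Set V × Set V) :=
  {t | (t.1, t.2.1, t.2.2 ∪ C) ∈ J ∧ (t.1 ∪ t.2.1 ∪ t.2.2) ∩ (M ∪ C) = ∅}

/-! ### Marked edge relations

An edge relation `E i a b j` records an edge between `i` and `j` which has an arrowhead at `i` iff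
`a = true` and an arrowhead at `j` iff `b = true`. Unlike the graphs of the main theorem, edge
relations may have loops, so that they are closed under concatenation of walks. -/

/-- The edge relation of a mixed graph. -/
def MixedGraph.edge (G : MixedGraph V) (i : V) (a b : Bool) (j : V) : Prop :=
  match a, b with
  | false, false => G.line i j
  | false, true => G.arrow i j
  | true, false => G.arrow j i
  | true, true => G.arc i j

/-- The generated edges, as an edge relation. -/
def GenEdge (G : MixedGraph V) (M S : Set V) (i : V) (a b : Bool) (j : V) : Prop :=
  match a, b with
  | false, false => GenLine G M S i j
  | false, true => GenArrow G M S i j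
  | true, false => GenArrow G M S j i
  | true, true => GenArc G M S i j

/-- The ancestor relation of an edge relation. -/
def Anc (E : V → Bool → Bool → V → Prop) (i j : V) : Prop :=
  Relation.TransGen (fun x y => E x false true y) i j

/-- The ancestors of a set with respect to an edge relation. -/
def ancSet (E : V → Bool → Bool → V → Prop) (C : Set V) : Set V := {i | ∃ c ∈ C, Anc E i c}

/-- An inner node with marks `p` and `q` lets a walk through: colliders have to be in `S` and
non-colliders in `M`. -/
def Passes (M S : Set V) (x : V) (p q : Bool) : Prop :=
  (p = true ∧ q = true → x ∈ S) ∧ (¬ (p = true ∧ q = true) → x ∈ M)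

/-- `Walk E M S l i a b j`: there is an m-connecting walk from `i` to `j` with list of inner nodes
`l`, and with marks `a` and `b` at its two ends. -/
inductive Walk (E : V → Bool → Bool → V → Prop) (M S : Set V) :
    List V → V → Bool → Bool → V → Prop
  | single {i j : V} {a b : Bool} : E i a b j → Walk E M S [] i a b j
  | cons {l : List V} {i x j : V} {a p q b : Bool} : E i a p x → Passes M S x p q →
      Walk E M S l x q b j → Walk E M S (x :: l) i a b j

/-- There is an m-connecting walk with the given marks at its ends. -/
def Conn (E : V → Bool → Bool → V → Prop) (M S : Set V) (i : V) (a b : Bool) (j : V) : Prop :=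
  ∃ l, Walk E M S l i a b j

/-- The mark `a` is what remains of the mark `a'` at `i` when arrowheads at `A` are removed. -/
def Dehead (A : Set V) (i : V) (a a' : Bool) : Prop := a = true ↔ a' = true ∧ i ∉ A

/-- Marginalisation over `M` and conditioning on `C`, with loops allowed. -/
def margCond (E : V → Bool → Bool → V → Prop) (M C : Set V) (i : V) (a b : Bool) (j : V) : Prop :=
  i ∉ M ∪ C ∧ j ∉ M ∪ C ∧ ∃ a' b', Conn E M (C ∪ ancSet E C) i a' b' j ∧
    Dehead (ancSet E C) i a a' ∧ Dehead (ancSet E C) j b b'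

/-- The defining properties of summary graphs, with loops allowed. -/
structure IsSummary (E : V → Bool → Bool → V → Prop) : Prop where
  symm : ∀ {i a b j}, E i a b j → E j b a i
  no_head : ∀ {i j k a}, E i false false j → ¬ E k a true i
  acyclic : ∀ i, ¬ Anc E i i

section Walks

variable {E : V → Bool → Bool → V → Prop} {M S C : Set V}

lemma Passes.swap {x : V} {p q : Bool} (h : Passes M S x p q) : Passes M S x q p :=
  ⟨fun hh => h.1 hh.symm, fun hh => h.2 fun h' => hh h'.symm⟩

lemma Passes.mono {M' S' : Set V} (hM : M ⊆ M') (hS : S ⊆ S') {x : V} {p q : Bool}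
    (h : Passes M S x p q) : Passes M' S' x p q :=
  ⟨fun hh => hS (h.1 hh), fun hh => hM (h.2 hh)⟩

lemma exists_dehead (A : Set V) (i : V) (a' : Bool) : ∃ a, Dehead A i a a' := by
  classical
  exact ⟨decide (a' = true ∧ i ∉ A), by simp [Dehead]⟩

lemma walk_append {l₁ l₂ : List V} {i x j : V} {a b : Bool} :
    Walk E M S (l₁ ++ x :: l₂) i a b j ↔
      ∃ p q, Walk E M S l₁ i a p x ∧ Passes M S x p q ∧ Walk E M S l₂ x q b j := by
  induction l₁ generalizing i a with
  | nil =>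
    constructor
    · rintro (_ | ⟨he, hp, hw⟩)
      exact ⟨_, _, .single he, hp, hw⟩
    · rintro ⟨p, q, ⟨he⟩, hp, hw⟩
      exact .cons he hp hw
  | cons y l₁ ih =>
    constructor
    · rintro (_ | ⟨he, hp, hw⟩)
      obtain ⟨p, q, h₁, h₂, h₃⟩ := ih.1 hw
      exact ⟨p, q, .cons he hp h₁, h₂, h₃⟩
    · rintro ⟨p, q, h₁, h₂, h₃⟩
      rcases h₁ with _ | ⟨he, hp, hw⟩
      exact .cons he hp (ih.2 ⟨p, q, hw, h₂, h₃⟩)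

lemma Conn.of_edge {i j : V} {a b : Bool} (h : E i a b j) : Conn E M S i a b j :=
  ⟨[], .single h⟩

lemma Conn.trans {i x j : V} {a p q b : Bool} (h₁ : Conn E M S i a p x)
    (hx : Passes M S x p q) (h₂ : Conn E M S x q b j) : Conn E M S i a b j := by
  obtain ⟨l₁, h₁⟩ := h₁
  obtain ⟨l₂, h₂⟩ := h₂
  exact ⟨_, walk_append.2 ⟨p, q, h₁, hx, h₂⟩⟩

lemma Walk.mono {M' S' : Set V} (hM : M ⊆ M') (hS : S ⊆ S') {l : List V} {i j : V} {a b : Bool}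
    (h : Walk E M S l i a b j) : Walk E M' S' l i a b j := by
  induction h with
  | single he => exact .single he
  | cons he hp _ ih => exact .cons he (hp.mono hM hS) ih

lemma Conn.mono {M' S' : Set V} (hM : M ⊆ M') (hS : S ⊆ S') {i j : V} {a b : Bool}
    (h : Conn E M S i a b j) : Conn E M' S' i a b j :=
  h.imp fun _ hw => hw.mono hM hS

lemma Conn.symm (hE : ∀ {i a b j}, E i a b j → E j b a i) {i j : V}
    {a b : Bool} (h : Conn E M S i a b j) :
    Conn E M S j b a i := by
  obtain ⟨l, h⟩ := h
  induction h with
  | single he => exact .of_edge (hE he)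
  | cons he hp _ ih => exact ih.trans hp.swap (.of_edge (hE he))

lemma Conn.exists_edge {i j : V} {a b : Bool} (h : Conn E M S i a b j) :
    ∃ c k, E i a c k := by
  obtain ⟨l, _ | _⟩ := h
  · exact ⟨_, _, ‹_›⟩
  · exact ⟨_, _, ‹_›⟩

lemma Conn.no_line_left (hE : IsSummary E) {i j k : V} {b : Bool} (h : Conn E M S i true b j) :
    ¬ E i false false k := fun hl => by
  obtain ⟨c, k, he⟩ := h.exists_edge
  exact hE.no_head hl (hE.symm he)

lemma Conn.no_line_right (hE : IsSummary E) {i j k : V} {a : Bool} (h : Conn E M S i a true j) :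
    ¬ E j false false k := (h.symm hE.symm).no_line_left hE

lemma ancSet_of_edge {i x : V} (h : E i false true x) (hx : x ∈ C ∪ ancSet E C) :
    i ∈ ancSet E C := by
  rcases hx with hx | ⟨c, hc, hxc⟩
  · exact ⟨x, hx, .single h⟩
  · exact ⟨c, hc, .head h hxc⟩

lemma ancSet_of_anc {i x : V} (h : Anc E i x) (hx : x ∈ ancSet E C) : i ∈ ancSet E C := by
  obtain ⟨c, hc, hxc⟩ := hx
  exact ⟨c, hc, h.trans hxc⟩

lemma ancSet_mono {C' : Set V} (h : C ⊆ C') : ancSet E C ⊆ ancSet E C' :=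
  fun _ ⟨c, hc, hi⟩ => ⟨c, h hc, hi⟩

/-- A walk leaving `i` through a tail starts with a line, leads down to `C`, or is directed. -/
lemma Conn.of_tail (hE : IsSummary E) {i j : V} {b : Bool}
    (h : Conn E M (C ∪ ancSet E C) i false b j) :
    (∃ k, E i false false k) ∨ i ∈ ancSet E C ∨ (b = true ∧ Anc E i j) := by
  obtain ⟨l, h⟩ := h
  generalize ha : false = a at h
  induction h with
  | @single i j a b he =>
    subst ha
    cases b
    · exact .inl ⟨_, he⟩
    · exact .inr (.inr ⟨rfl, .single he⟩)
  | @cons l i x j a p q b he hp hw ih =>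
    subst ha
    cases p
    · exact .inl ⟨_, he⟩
    cases q
    · rcases ih rfl with ⟨k, hk⟩ | hx | ⟨hb, hx⟩
      · exact absurd he (hE.no_head hk)
      · exact .inr (.inl (ancSet_of_edge he (.inr hx)))
      · exact .inr (.inr ⟨hb, .head he hx⟩)
    · exact .inr (.inl (ancSet_of_edge he (hp.1 ⟨rfl, rfl⟩)))

/-- Removing the closed part of a walk between two visits of an inner node. -/
lemma Passes.shortcut (hE : IsSummary E) {i x : V} {a p q r s : Bool}
    (hi : Conn E M (C ∪ ancSet E C) i a p x) (hpq : Passes M (C ∪ ancSet E C) x p q)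
    (hx : Conn E M (C ∪ ancSet E C) x q r x) (hrs : Passes M (C ∪ ancSet E C) x r s) :
    Passes M (C ∪ ancSet E C) x p s := by
  refine ⟨fun ⟨hp, hs⟩ => ?_, fun hps => ?_⟩
  · subst hp hs
    cases q
    · cases r
      · rcases hx.of_tail hE with ⟨k, hk⟩ | hx | ⟨hb, -⟩
        · exact absurd hk (hi.no_line_right hE)
        · exact .inr hx
        · cases hb
      · exact hrs.1 ⟨rfl, rfl⟩
    · exact hpq.1 ⟨rfl, rfl⟩
  · cases p
    · exact hpq.2 (by simp)
    · cases s
      · exact hrs.2 (by simp)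
      · exact absurd ⟨rfl, rfl⟩ hps

lemma Passes.mem_ancSet {x : V} {p q : Bool} (hx : x ∉ M ∪ C)
    (h : Passes M (C ∪ ancSet E C) x p q) : x ∈ ancSet E C := by
  by_cases hpq : p = true ∧ q = true
  · exact (h.1 hpq).resolve_left fun hc => hx (.inr hc)
  · exact absurd (.inl (h.2 hpq)) hx

lemma exists_two_of_not_nodup {l : List V} (h : ¬ l.Nodup) :
    ∃ x l₁ l₂ l₃, l = l₁ ++ x :: (l₂ ++ x :: l₃) := by
  induction l with
  | nil => simp at h
  | cons y l ih =>
    by_cases hy : y ∈ l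
    · obtain ⟨l₂, l₃, rfl⟩ := List.append_of_mem hy
      exact ⟨y, [], l₂, l₃, rfl⟩
    · obtain ⟨x, l₁, l₂, l₃, rfl⟩ := ih fun hl => h (List.nodup_cons.2 ⟨hy, hl⟩)
      exact ⟨x, y :: l₁, l₂, l₃, rfl⟩

/-- Every m-connecting walk between distinct remaining nodes can be shortened to a path, up to
arrowheads at ancestors of `C`. -/
lemma Walk.exists_path (hE : IsSummary E) {l : List V} {i j : V} {a b : Bool} (hij : i ≠ j)
    (hi : i ∉ M ∪ C) (hj : j ∉ M ∪ C) (h : Walk E M (C ∪ ancSet E C) l i a b j) :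
    ∃ l' a' b', Walk E M (C ∪ ancSet E C) l' i a' b' j ∧ (i :: (l' ++ [j])).Nodup ∧
      (i ∉ ancSet E C → a' = a) ∧ (j ∉ ancSet E C → b' = b) := by
  induction hn : l.length using Nat.strong_induction_on generalizing l a b with
  | _ n ih =>
    subst hn
    by_cases hil : i ∈ l
    · obtain ⟨l₁, l₂, rfl⟩ := List.append_of_mem hil
      obtain ⟨p, q, -, hp, hw⟩ := walk_append.1 h
      obtain ⟨l', a', b', h', hnd, -, hb⟩ := ih _ (by simp; omega) hw rfl
      exact ⟨l', a', b', h', hnd, fun hia => absurd (hp.mem_ancSet hi) hia, hb⟩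
    by_cases hjl : j ∈ l
    · obtain ⟨l₁, l₂, rfl⟩ := List.append_of_mem hjl
      obtain ⟨p, q, hw, hp, -⟩ := walk_append.1 h
      obtain ⟨l', a', b', h', hnd, ha, -⟩ := ih _ (by simp) hw rfl
      exact ⟨l', a', b', h', hnd, ha, fun hja => absurd (hp.mem_ancSet hj) hja⟩
    by_cases hl : l.Nodup
    · refine ⟨l, a, b, h, ?_, fun _ => rfl, fun _ => rfl⟩
      rw [List.nodup_cons, List.nodup_append]
      refine ⟨by simp [hil, hij], hl, by simp, ?_⟩
      rintro y hy _ hz rfl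
      exact hjl (List.mem_singleton.1 hz ▸ hy)
    · obtain ⟨x, l₁, l₂, l₃, rfl⟩ := exists_two_of_not_nodup hl
      obtain ⟨p, q, h₁, hpq, h₂⟩ := walk_append.1 h
      obtain ⟨r, s, h₂, hrs, h₃⟩ := walk_append.1 h₂
      exact ih _ (by simp)
        (walk_append.2 ⟨p, s, h₁, .shortcut hE ⟨_, h₁⟩ hpq ⟨_, h₂⟩ hrs, h₃⟩) rfl

end Walks

/-! ### Generated edges and walks -/

section Generated

variable {G : MixedGraph V} {M S : Set V}

lemma GenEdge.trans {i x j : V} {a p q b : Bool} (h₁ : GenEdge G M S i a p x)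
    (hx : Passes M S x p q) (h₂ : GenEdge G M S x q b j) (hij : i ≠ j) :
    GenEdge G M S i a b j := by
  have hji := hij.symm
  cases p <;> cases q <;> simp only [Passes, Bool.false_eq_true, true_and, and_true, and_false,
    and_self, not_true_eq_false, not_false_eq_true, true_imp_iff, false_imp_iff] at hx
  · cases a <;> cases b
    · exact .row7 hx hij h₁ h₂
    · exact .row2 hx hij h₁ h₂
    · exact .row2 hx hji h₂.symm h₁
    · exact .row4 hx hij h₁ h₂
  · cases a <;> cases b
    · exact .row6 hx hij h₁ h₂
    · exact .row3 hx hij h₁ h₂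
    · exact .row1 hx hji h₂ h₁
    · exact .row5 hx hij h₁ h₂
  · cases a <;> cases b
    · exact (GenLine.row6 hx hji h₂.symm h₁).symm
    · exact .row1 hx hij h₁ h₂
    · exact .row3 hx hji h₂.symm h₁.symm
    · exact (GenArc.row5 hx hji h₂ h₁.symm).symm
  · cases a <;> cases b
    · exact .row10 hx hij h₁ h₂
    · exact .row8 hx hij h₁ h₂
    · exact .row8 hx hji h₂ h₁.symm
    · exact .row9 hx hij h₁ h₂

variable {E : V → Bool → Bool → V → Prop}

lemma Walk.genEdge (hG : ∀ i a b j, G.edge i a b j ↔ i ≠ j ∧ E i a b j) {l : List V} {i j : V}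
    {a b : Bool} (h : Walk E M S l i a b j) (hl : (i :: (l ++ [j])).Nodup) :
    GenEdge G M S i a b j := by
  have of_edge {i j : V} {a b : Bool} (hij : i ≠ j) (he : E i a b j) : GenEdge G M S i a b j := by
    have := (hG i a b j).2 ⟨hij, he⟩
    cases a <;> cases b <;> exact .base this
  induction h with
  | single he => exact of_edge (by simpa using hl) he
  | cons he hp _ ih =>
    obtain ⟨h₁, h₂⟩ := List.nodup_cons.1 hl
    simp only [List.cons_append, List.mem_cons, List.mem_append, not_or] at h₁
    exact (of_edge h₁.1 he).trans hp (ih h₂) fun h => h₁.2.2.1 h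

lemma passes_nonCollider {x : V} {p q : Bool} (hx : x ∈ M) (h : ¬ (p = true ∧ q = true)) :
    Passes M S x p q := ⟨fun h' => absurd h' h, fun _ => hx⟩

lemma passes_collider {x : V} (hx : x ∈ S) : Passes M S x true true :=
  ⟨fun _ => hx, fun h => absurd ⟨rfl, rfl⟩ h⟩

mutual

lemma GenArrow.conn (hs : ∀ {i a b j}, E i a b j → E j b a i)
    (hG : ∀ i a b j, G.edge i a b j → i ≠ j ∧ E i a b j) {i j : V} :
    GenArrow G M S i j → i ≠ j ∧ Conn E M S i false true j
  | .base h => (hG i false true j h).imp_right .of_edge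
  | .row1 hm hij h₁ h₂ => ⟨hij, (h₁.conn hs hG).2.trans
      (passes_nonCollider hm (by simp)) (h₂.conn hs hG).2⟩
  | .row2 hm hij h₁ h₂ => ⟨hij, (h₁.conn hs hG).2.trans
      (passes_nonCollider hm (by simp)) (h₂.conn hs hG).2⟩
  | .row3 hm hij h₁ h₂ => ⟨hij, (h₁.conn hs hG).2.trans
      (passes_nonCollider hm (by simp)) (h₂.conn hs hG).2⟩
  | .row8 hx hij h₁ h₂ => ⟨hij, (h₁.conn hs hG).2.trans
      (passes_collider hx) (h₂.conn hs hG).2⟩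

lemma GenArc.conn (hs : ∀ {i a b j}, E i a b j → E j b a i)
    (hG : ∀ i a b j, G.edge i a b j → i ≠ j ∧ E i a b j) {i j : V} :
    GenArc G M S i j → i ≠ j ∧ Conn E M S i true true j
  | .base h => (hG i true true j h).imp_right .of_edge
  | .symm h => ⟨(h.conn hs hG).1.symm, (h.conn hs hG).2.symm hs⟩
  | .row4 hm hij h₁ h₂ => ⟨hij, ((h₁.conn hs hG).2.symm hs).trans
      (passes_nonCollider hm (by simp)) (h₂.conn hs hG).2⟩
  | .row5 hm hij h₁ h₂ => ⟨hij, ((h₁.conn hs hG).2.symm hs).trans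
      (passes_nonCollider hm (by simp)) (h₂.conn hs hG).2⟩
  | .row9 hx hij h₁ h₂ => ⟨hij, (h₁.conn hs hG).2.trans
      (passes_collider hx) (h₂.conn hs hG).2⟩

lemma GenLine.conn (hs : ∀ {i a b j}, E i a b j → E j b a i)
    (hG : ∀ i a b j, G.edge i a b j → i ≠ j ∧ E i a b j) {i j : V} :
    GenLine G M S i j → i ≠ j ∧ Conn E M S i false false j
  | .base h => (hG i false false j h).imp_right .of_edge
  | .symm h => ⟨(h.conn hs hG).1.symm, (h.conn hs hG).2.symm hs⟩
  | .row6 hm hij h₁ h₂ => ⟨hij, (h₁.conn hs hG).2.trans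
      (passes_nonCollider hm (by simp)) ((h₂.conn hs hG).2.symm hs)⟩
  | .row7 hm hij h₁ h₂ => ⟨hij, (h₁.conn hs hG).2.trans
      (passes_nonCollider hm (by simp)) (h₂.conn hs hG).2⟩
  | .row10 hx hij h₁ h₂ => ⟨hij, (h₁.conn hs hG).2.trans
      (passes_collider hx) ((h₂.conn hs hG).2.symm hs)⟩

end

lemma GenEdge.conn (hs : ∀ {i a b j}, E i a b j → E j b a i)
    (hG : ∀ i a b j, G.edge i a b j → i ≠ j ∧ E i a b j) {i j : V} {a b : Bool}
    (h : GenEdge G M S i a b j) : i ≠ j ∧ Conn E M S i a b j := by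
  cases a <;> cases b
  · exact GenLine.conn hs hG h
  · exact GenArrow.conn hs hG h
  · exact (GenArrow.conn hs hG h).imp Ne.symm (Conn.symm hs)
  · exact GenArc.conn hs hG h

lemma alphaSG_edge_iff {C : Set V} {i j : V} {a b : Bool} :
    (alphaSG G M C).edge i a b j ↔ i ∈ G.nodes \ (M ∪ C) ∧ j ∈ G.nodes \ (M ∪ C) ∧
      ∃ a' b', GenEdge G M (C ∪ G.anSet C) i a' b' j ∧
        Dehead (G.anSet C) i a a' ∧ Dehead (G.anSet C) j b b' := by
  have harc : GenArc G M (C ∪ G.anSet C) j i ↔ GenArc G M (C ∪ G.anSet C) i j := ⟨.symm, .symm⟩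
  cases a <;> cases b <;>
    simp only [MixedGraph.edge, alphaSG, deheadAt, alphaRG, Bool.exists_bool, GenEdge, Dehead,
      Bool.false_eq_true, false_and, true_and, false_iff, true_iff, not_not, not_false_eq_true,
      and_true, and_false, harc] <;>
    tauto

/-- The summary graph generated from `G` consists of the marginalised and conditioned edges of `G`
that are not loops. -/
lemma alphaSG_edge_iff_margCond {C : Set V} (hE : IsSummary E)
    (hG : ∀ i a b j, G.edge i a b j ↔ i ≠ j ∧ E i a b j)
    (hN : ∀ i a b j, G.edge i a b j → i ∈ G.nodes) (i : V) (a b : Bool) (j : V) :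
    (alphaSG G M C).edge i a b j ↔ i ≠ j ∧ margCond E M C i a b j := by
  have hA : G.anSet C = ancSet E C := by
    have : G.arrow = fun i j => E i false true j := by
      ext i j
      refine (hG i false true j).trans ⟨And.right, fun h => ⟨?_, h⟩⟩
      rintro rfl
      exact hE.acyclic i (.single h)
    simp only [MixedGraph.anSet, ancSet, MixedGraph.anc, Anc, this]
  have hs {i a b j} (h : G.edge i a b j) : G.edge j b a i := by
    obtain ⟨hij, h⟩ := (hG ..).1 h
    exact (hG ..).2 ⟨hij.symm, hE.symm h⟩
  have hN' {i a b j} (h : GenEdge G M (C ∪ G.anSet C) i a b j) : i ∈ G.nodes ∧ j ∈ G.nodes := by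
    have hc := (h.conn hs fun i a b j h => ⟨((hG i a b j).1 h).1, h⟩).2
    obtain ⟨_, _, h₁⟩ := hc.exists_edge
    obtain ⟨_, _, h₂⟩ := (hc.symm hs).exists_edge
    exact ⟨hN _ _ _ _ h₁, hN _ _ _ _ h₂⟩
  rw [alphaSG_edge_iff]
  constructor
  · rintro ⟨hi, hj, a', b', h, ha, hb⟩
    obtain ⟨hij, hc⟩ := h.conn hE.symm fun i a b j => (hG i a b j).1
    rw [hA] at hc ha hb
    exact ⟨hij, hi.2, hj.2, a', b', hc, ha, hb⟩
  · rintro ⟨hij, hi, hj, a', b', ⟨l, hc⟩, ha, hb⟩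
    obtain ⟨l', a'', b'', hw, hnd, ha', hb'⟩ := hc.exists_path hE hij hi hj
    have hg := hw.genEdge hG hnd
    rw [← hA] at hg ha hb ha' hb'
    refine ⟨⟨(hN' hg).1, hi⟩, ⟨(hN' hg).2, hj⟩, a'', b'', hg, ?_, ?_⟩
    · exact ha.trans (and_congr_left fun h => by rw [ha' h])
    · exact hb.trans (and_congr_left fun h => by rw [hb' h])

end Generated

/-! ### Composition -/

section Composition

variable {E : V → Bool → Bool → V → Prop} {M C M₁ C₁ : Set V}

lemma margCond_arrow (hE : IsSummary E) {i j : V} (h : margCond E M C i false true j) :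
    ((∃ k, E i false false k) ∨ i ∈ ancSet E C ∨ Anc E i j) ∧ j ∉ ancSet E C ∧
      ∀ k, ¬ E j false false k := by
  obtain ⟨-, -, a', b', hc, ha, hb⟩ := h
  obtain ⟨rfl, hj⟩ := hb.1 rfl
  refine ⟨?_, hj, fun k => hc.no_line_right hE⟩
  cases a'
  · rcases hc.of_tail hE with h | h | ⟨-, h⟩
    exacts [.inl h, .inr (.inl h), .inr (.inr h)]
  · simp [Dehead] at ha
    exact .inr (.inl ha)

lemma margCond_anc (hE : IsSummary E) {i j : V} (h : Anc (margCond E M C) i j) :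
    (∃ k, E i false false k) ∨ i ∈ ancSet E C ∨ Anc E i j := by
  induction h using Relation.TransGen.head_induction_on with
  | single h => exact (margCond_arrow hE h).1
  | head h _ ih =>
    obtain ⟨h₁, h₂, h₃⟩ := margCond_arrow hE h
    rcases h₁ with h₁ | h₁ | h₁
    · exact .inl h₁
    · exact .inr (.inl h₁)
    · rcases ih with ⟨k, hk⟩ | ih | ih
      · exact absurd hk (h₃ k)
      · exact absurd ih h₂
      · exact .inr (.inr (h₁.trans ih))

lemma margCond_isSummary (hE : IsSummary E) : IsSummary (margCond E M C) where
  symm := fun ⟨hi, hj, a', b', hc, ha, hb⟩ => ⟨hj, hi, b', a', hc.symm hE.symm, hb, ha⟩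
  no_head := by
    rintro i j k a ⟨-, -, a', b', hc, ha, hb⟩ ⟨-, -, c', d', hc', -, hd⟩
    obtain ⟨rfl, hi⟩ := hd.1 rfl
    cases a'
    · rcases hc.of_tail hE with ⟨k, hk⟩ | h | ⟨rfl, h⟩
      · exact hc'.no_line_right hE hk
      · exact hi h
      · simp [Dehead] at hb
        exact hi (ancSet_of_anc h hb)
    · simp [Dehead] at ha
      exact hi ha
  acyclic := by
    intro i h
    obtain ⟨k, -, hk⟩ := Relation.TransGen.tail'_iff.1 h
    obtain ⟨-, h₂, h₃⟩ := margCond_arrow hE hk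
    rcases margCond_anc hE h with ⟨k, hk⟩ | h | h
    · exact h₃ k hk
    · exact h₂ h
    · exact hE.acyclic i h

/-- Ancestors of the conditioning sets reach, along a directed walk through `M`, a remaining node
which is conditioned on, or an ancestor of such a node, in the second stage. -/
lemma exists_conn_of_anc (hMC₁ : Disjoint M C₁) (hCC₁ : Disjoint C C₁) {i : V}
    (hi : i ∉ ancSet E C) (h : i ∈ ancSet E (C ∪ C₁)) :
    ∃ d, d ∉ M ∪ C ∧ d ∉ ancSet E C ∧ d ∈ C₁ ∪ ancSet (margCond E M C) C₁ ∧
      Conn E M (C ∪ ancSet E C) i false true d := by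
  obtain ⟨c, hc, h⟩ := h
  induction h using Relation.TransGen.head_induction_on with
  | single h =>
    rcases hc with hc | hc
    · exact absurd (ancSet_of_edge h (.inl hc)) hi
    · refine ⟨c, ?_, fun h' => hi (ancSet_of_edge h (.inr h')), .inl hc, .of_edge h⟩
      rintro (h | h)
      exacts [hMC₁.notMem_of_mem_left h hc, hCC₁.notMem_of_mem_left h hc]
  | @head i y h _ ih =>
    have hyA : y ∉ ancSet E C := fun h' => hi (ancSet_of_edge h (.inr h'))
    have hyC : y ∉ C := fun h' => hi (ancSet_of_edge h (.inl h'))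
    obtain ⟨d, hd, hdA, hd₁, hw⟩ := ih hyA
    by_cases hyM : y ∈ M
    · exact ⟨d, hd, hdA, hd₁, .trans (.of_edge h) (passes_nonCollider hyM (by simp)) hw⟩
    · have hyMC : y ∉ M ∪ C := fun h' => h'.elim hyM hyC
      refine ⟨y, hyMC, hyA, .inr (ancSet_of_edge ?_ hd₁), .of_edge h⟩
      exact ⟨hyMC, hd, _, _, hw, by simp [Dehead], by simp [Dehead, hdA]⟩

lemma mem_ancSet_margCond (hMC₁ : Disjoint M C₁) (hCC₁ : Disjoint C C₁) {i : V}
    (hi : i ∉ M ∪ C) (hiA : i ∉ ancSet E C) (h : i ∈ ancSet E (C ∪ C₁)) :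
    i ∈ ancSet (margCond E M C) C₁ := by
  obtain ⟨d, hd, hdA, hd₁, hw⟩ := exists_conn_of_anc (M := M) hMC₁ hCC₁ hiA h
  exact ancSet_of_edge ⟨hi, hd, _, _, hw, by simp [Dehead], by simp [Dehead, hdA]⟩ hd₁

lemma ancSet_of_margCond (hE : IsSummary E) {i : V} (hi : ∀ k, ¬ E i false false k)
    (h : i ∈ ancSet (margCond E M C) C₁) : i ∈ ancSet E (C ∪ C₁) := by
  obtain ⟨c, hc, h⟩ := h
  rcases margCond_anc hE h with ⟨k, hk⟩ | h | h
  · exact absurd hk (hi k)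
  · exact ancSet_mono Set.subset_union_left h
  · exact ⟨c, .inr hc, h⟩

/-- Removing arrowheads in two stages. -/
lemma dehead_trans_iff (hE : IsSummary E) (hMC₁ : Disjoint M C₁) (hCC₁ : Disjoint C C₁)
    {i : V} (hi : i ∉ M ∪ C) {a a₁ a' : Bool} (hh : a' = true → ∀ k, ¬ E i false false k)
    (h : Dehead (ancSet E C) i a₁ a') :
    Dehead (ancSet (margCond E M C) C₁) i a a₁ ↔ Dehead (ancSet E (C ∪ C₁)) i a a' := by
  unfold Dehead at *
  rw [h, and_assoc]
  have : a' = true → (i ∉ ancSet E C ∧ i ∉ ancSet (margCond E M C) C₁ ↔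
      i ∉ ancSet E (C ∪ C₁)) := fun ha => by
    constructor
    · exact fun ⟨h₁, h₂⟩ h₃ => h₂ (mem_ancSet_margCond hMC₁ hCC₁ hi h₁ h₃)
    · exact fun h₁ => ⟨fun h₂ => h₁ (ancSet_mono Set.subset_union_left h₂),
        fun h₂ => h₁ (ancSet_of_margCond hE (hh ha) h₂)⟩
  rw [and_congr_right this]

/-- A walk of second-stage edges expands to a walk of original edges. -/
lemma Walk.expand (hE : IsSummary E) {l : List V} {i j : V} {a b : Bool}
    (h : Walk (margCond E M C) M₁ (C₁ ∪ ancSet (margCond E M C) C₁) l i a b j) :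
    ∃ a' b', Conn E (M ∪ M₁) (C ∪ C₁ ∪ ancSet E (C ∪ C₁)) i a' b' j ∧
      Dehead (ancSet E C) i a a' ∧ Dehead (ancSet E C) j b b' := by
  have hmono {i a b j} (h : Conn E M (C ∪ ancSet E C) i a b j) :
      Conn E (M ∪ M₁) (C ∪ C₁ ∪ ancSet E (C ∪ C₁)) i a b j :=
    h.mono Set.subset_union_left
      (Set.union_subset_union Set.subset_union_left (ancSet_mono Set.subset_union_left))
  induction h with
  | single h =>
    obtain ⟨-, -, a', b', hc, ha, hb⟩ := h
    exact ⟨a', b', hmono hc, ha, hb⟩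
  | @cons l i x j a p q b he hp _ ih =>
    obtain ⟨-, -, a', p', hc, ha, hp'⟩ := he
    obtain ⟨q', b', hc', hq', hb⟩ := ih
    refine ⟨a', b', (hmono hc).trans ⟨?_, fun hpq => ?_⟩ hc', ha, hb⟩
    · rintro ⟨rfl, rfl⟩
      by_cases hx : x ∈ ancSet E C
      · exact .inr (ancSet_mono Set.subset_union_left hx)
      · rcases hp.1 ⟨hp'.2 ⟨rfl, hx⟩, hq'.2 ⟨rfl, hx⟩⟩ with h | h
        · exact .inl (.inr h)
        · exact .inr (ancSet_of_margCond hE (fun k => hc.no_line_right hE) h)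
    · exact .inr (hp.2 fun ⟨h₁, h₂⟩ => hpq ⟨(hp'.1 h₁).1, (hq'.1 h₂).1⟩)

/-- A walk that starts with a first-stage segment from `i`, and proceeds, if at all, along
second-stage edges. -/
def SplitConn (E : V → Bool → Bool → V → Prop) (M C M₁ C₁ : Set V) (i : V) (a b : Bool) (j : V) :
    Prop :=
  Conn E M (C ∪ ancSet E C) i a b j ∨ ∃ x p p₁ q₁ b₁, x ∉ M ∪ C ∧
    Conn E M (C ∪ ancSet E C) i a p x ∧ Dehead (ancSet E C) x p₁ p ∧
    Passes M₁ (C₁ ∪ ancSet (margCond E M C) C₁) x p₁ q₁ ∧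
    Conn (margCond E M C) M₁ (C₁ ∪ ancSet (margCond E M C) C₁) x q₁ b₁ j ∧
    Dehead (ancSet E C) j b₁ b

lemma SplitConn.conn {i j : V} {a b : Bool} (hi : i ∉ M ∪ C) (hj : j ∉ M ∪ C)
    (h : SplitConn E M C M₁ C₁ i a b j) :
    ∃ a₁ b₁, Conn (margCond E M C) M₁ (C₁ ∪ ancSet (margCond E M C) C₁) i a₁ b₁ j ∧
      Dehead (ancSet E C) i a₁ a ∧ Dehead (ancSet E C) j b₁ b := by
  obtain ⟨a₁, ha⟩ := exists_dehead (ancSet E C) i a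
  rcases h with h | ⟨x, p, p₁, q₁, b₁, hx, hc, hp, hpq, hc', hb⟩
  · obtain ⟨b₁, hb⟩ := exists_dehead (ancSet E C) j b
    exact ⟨a₁, b₁, .of_edge ⟨hi, hj, a, b, h, ha, hb⟩, ha, hb⟩
  · exact ⟨a₁, b₁, .trans (.of_edge ⟨hi, hx, a, p, hc, ha, hp⟩) hpq hc', ha, hb⟩

lemma SplitConn.cons {i x j : V} {a p q b : Bool} (hc : Conn E M (C ∪ ancSet E C) i a p x)
    (hx : Passes M (C ∪ ancSet E C) x p q) (h : SplitConn E M C M₁ C₁ x q b j) :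
    SplitConn E M C M₁ C₁ i a b j := by
  rcases h with h | ⟨y, r, r₁, s₁, b₁, hy, hc', h⟩
  · exact .inl (hc.trans hx h)
  · exact .inr ⟨y, r, r₁, s₁, b₁, hy, hc.trans hx hc', h⟩

/-- A walk of original edges splits into first-stage segments. -/
lemma Walk.splitConn (hE : IsSummary E) (hMM₁ : Disjoint M M₁) (hMC₁ : Disjoint M C₁)
    (hCM₁ : Disjoint C M₁) (hCC₁ : Disjoint C C₁) {l : List V} {i j : V} {a b : Bool}
    (hj : j ∉ M ∪ C) (h : Walk E (M ∪ M₁) (C ∪ C₁ ∪ ancSet E (C ∪ C₁)) l i a b j) :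
    SplitConn E M C M₁ C₁ i a b j := by
  induction h with
  | single h => exact .inl (.of_edge h)
  | @cons l i x j a p q b he hp _ ih =>
    replace ih := ih hj
    by_cases hpass : Passes M (C ∪ ancSet E C) x p q
    · exact ih.cons (.of_edge he) hpass
    by_cases hpq : p = true ∧ q = true
    · obtain ⟨rfl, rfl⟩ := hpq
      have hxS : x ∉ C ∪ ancSet E C := fun h => hpass (passes_collider h)
      obtain ⟨hxC, hxA⟩ := not_or.1 hxS
      have hx := hp.1 ⟨rfl, rfl⟩
      by_cases hxM : x ∈ M
      · have hxA' : x ∈ ancSet E (C ∪ C₁) := by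
          rcases hx with (h | h) | h
          · exact absurd h hxC
          · exact absurd h (hMC₁.notMem_of_mem_left hxM)
          · exact h
        obtain ⟨d, hd, hdA, hd₁, hw⟩ := exists_conn_of_anc (M := M) hMC₁ hCC₁ hxA hxA'
        obtain ⟨q₁, b₁, hc, hq, hb⟩ := SplitConn.conn hd hj
          (ih.cons (hw.symm hE.symm) (passes_nonCollider hxM (by simp)))
        obtain rfl : q₁ = true := hq.2 ⟨rfl, hdA⟩
        exact .inr ⟨d, true, true, true, b₁, hd,
          .trans (.of_edge he) (passes_nonCollider hxM (by simp)) hw, by simp [Dehead, hdA],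
          passes_collider hd₁, hc, hb⟩
      · have hxMC : x ∉ M ∪ C := fun h => h.elim hxM hxC
        obtain ⟨q₁, b₁, hc, hq, hb⟩ := ih.conn hxMC hj
        obtain rfl : q₁ = true := hq.2 ⟨rfl, hxA⟩
        refine .inr ⟨x, true, true, true, b₁, hxMC, .of_edge he, by simp [Dehead, hxA],
          passes_collider ?_, hc, hb⟩
        rcases hx with (h | h) | h
        · exact absurd h hxC
        · exact .inl h
        · exact .inr (mem_ancSet_margCond hMC₁ hCC₁ hxMC hxA h)
    · have hxM₁ : x ∈ M₁ := (hp.2 hpq).resolve_left fun h => hpass (passes_nonCollider h hpq)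
      have hxMC : x ∉ M ∪ C := by
        rintro (h | h)
        exacts [hMM₁.notMem_of_mem_left h hxM₁, hCM₁.notMem_of_mem_left h hxM₁]
      obtain ⟨q₁, b₁, hc, hq, hb⟩ := ih.conn hxMC hj
      obtain ⟨p₁, hp₁⟩ := exists_dehead (ancSet E C) x p
      exact .inr ⟨x, p, p₁, q₁, b₁, hxMC, .of_edge he, hp₁, passes_nonCollider hxM₁
        fun ⟨h₁, h₂⟩ => hpq ⟨(hp₁.1 h₁).1, (hq.1 h₂).1⟩, hc, hb⟩

theorem margCond_margCond (hE : IsSummary E) (hMM₁ : Disjoint M M₁) (hMC₁ : Disjoint M C₁)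
    (hCM₁ : Disjoint C M₁) (hCC₁ : Disjoint C C₁) (i : V) (a b : Bool) (j : V) :
    margCond (margCond E M C) M₁ C₁ i a b j ↔ margCond E (M ∪ M₁) (C ∪ C₁) i a b j := by
  have hU (x : V) : x ∉ M ∪ M₁ ∪ (C ∪ C₁) ↔ x ∉ M ∪ C ∧ x ∉ M₁ ∪ C₁ := by
    simp only [Set.mem_union]
    tauto
  constructor
  · rintro ⟨hi, hj, a₁, b₁, hc₁, ha, hb⟩
    obtain ⟨_, _, he, -⟩ := hc₁.exists_edge
    obtain ⟨_, _, he', -⟩ := (hc₁.symm (margCond_isSummary hE).symm).exists_edge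
    obtain ⟨l, hc₁⟩ := hc₁
    obtain ⟨a', b', hc, ha', hb'⟩ := hc₁.expand hE
    refine ⟨(hU i).2 ⟨he, hi⟩, (hU j).2 ⟨he', hj⟩, a', b', hc, ?_, ?_⟩
    · refine (dehead_trans_iff hE hMC₁ hCC₁ he ?_ ha').1 ha
      rintro rfl k
      exact hc.no_line_left hE
    · refine (dehead_trans_iff hE hMC₁ hCC₁ he' ?_ hb').1 hb
      rintro rfl k
      exact hc.no_line_right hE
  · rintro ⟨hi, hj, a', b', hc, ha, hb⟩
    obtain ⟨hi, hi₁⟩ := (hU i).1 hi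
    obtain ⟨hj, hj₁⟩ := (hU j).1 hj
    have hl : a' = true → ∀ k, ¬ E i false false k := by
      rintro rfl k
      exact hc.no_line_left hE
    have hr : b' = true → ∀ k, ¬ E j false false k := by
      rintro rfl k
      exact hc.no_line_right hE
    obtain ⟨l, hc⟩ := hc
    obtain ⟨a₁, b₁, hc₁, ha', hb'⟩ :=
      (hc.splitConn hE hMM₁ hMC₁ hCM₁ hCC₁ hj).conn hi hj
    exact ⟨hi₁, hj₁, a₁, b₁, hc₁, (dehead_trans_iff hE hMC₁ hCC₁ hi hl ha').2 ha,
      (dehead_trans_iff hE hMC₁ hCC₁ hj hr hb').2 hb⟩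

end Composition

lemma MixedGraph.ext_edge {G G' : MixedGraph V} (hN : G.nodes = G'.nodes)
    (h : ∀ i a b j, G.edge i a b j ↔ G'.edge i a b j) : G = G' := by
  cases G
  cases G'
  simp only [MixedGraph.mk.injEq]
  exact ⟨hN, by ext i j; exact h i false true j, by ext i j; exact h i true true j,
    by ext i j; exact h i false false j⟩

lemma MixedGraph.IsSG.isSummary {H : MixedGraph V} (hH : H.IsSG) : IsSummary H.edge where
  symm := by
    rintro i (_ | _) (_ | _) j h
    exacts [hH.1.1.2.1 _ _ h, h, h, hH.1.1.1 _ _ h]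
  no_head := by
    rintro i j k (_ | _) h h'
    exacts [(hH.2.1 i ⟨j, h⟩ k).1 h', (hH.2.1 i ⟨j, h⟩ k).2 h']
  acyclic := hH.2.2

lemma MixedGraph.Wf.mem_nodes {H : MixedGraph V} (hH : H.Wf) (i : V) (a b : Bool) (j : V)
    (h : H.edge i a b j) : i ∈ H.nodes := by
  cases a <;> cases b
  exacts [(hH.2.2 _ _ (.inr (.inr h))).1, (hH.2.2 _ _ (.inl h)).1, (hH.2.2 _ _ (.inl h)).2,
    (hH.2.2 _ _ (.inr (.inl h))).1]

lemma MixedGraph.Loopless.ne {H : MixedGraph V} (hH : H.Loopless) {i : V} {a b : Bool} {j : V}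
    (h : H.edge i a b j) : i ≠ j := by
  rintro rfl
  cases a <;> cases b
  exacts [(hH i).2.2 h, (hH i).1 h, (hH i).1 h, (hH i).2.1 h]

/-- (Theorem 3) `α_SG` is well-defined with respect to
splitting the marginalisation and conditioning sets: for a summary graph `H`
and pairwise disjoint subsets `C`, `C₁`, `M`, `M₁` of its node set,
`α_SG(α_SG(H;M,C);M₁,C₁) = α_SG(H;M∪M₁,C∪C₁)`. -/
theorem stmt_11 {V : Type} (H : MixedGraph V) (M C M₁ C₁ : Set V)
    (hH : H.IsSG)
    (hM : M ⊆ H.nodes) (hC : C ⊆ H.nodes)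
    (hM₁ : M₁ ⊆ H.nodes) (hC₁ : C₁ ⊆ H.nodes)
    (hMC : Disjoint M C) (hMM₁ : Disjoint M M₁) (hMC₁ : Disjoint M C₁)
    (hCM₁ : Disjoint C M₁) (hCC₁ : Disjoint C C₁) (hM₁C₁ : Disjoint M₁ C₁) :
    alphaSG (alphaSG H M C) M₁ C₁ = alphaSG H (M ∪ M₁) (C ∪ C₁) := by
  have hE := hH.isSummary
  have hG (i : V) (a b : Bool) (j : V) : H.edge i a b j ↔ i ≠ j ∧ H.edge i a b j :=
    ⟨fun h => ⟨hH.1.2.1.ne h, h⟩, And.right⟩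
  have hN := hH.1.1.mem_nodes
  refine MixedGraph.ext_edge ?_ fun i a b j => ?_
  · ext x
    simp only [alphaSG, deheadAt, alphaRG, Set.mem_sdiff, Set.mem_union]
    tauto
  · rw [alphaSG_edge_iff_margCond (margCond_isSummary hE)
        (alphaSG_edge_iff_margCond hE hG hN) fun i a b j h => (alphaSG_edge_iff.1 h).1,
      alphaSG_edge_iff_margCond hE hG hN, margCond_margCond hE hMM₁ hMC₁ hCM₁ hCC₁]

end StableMixedGraphs
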